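/- arXiv:0712.4321 — 2 statements merged into one kernel-verified Lean document; each statement's English description precedes it below -/
import Mathlib

section
/- Let q be a prime power. For all δ and r' such that 0 ≤ δ < (q−1)/2 and 0 ≤ r' < q − 2δ − 2, there exists a pure F_q-linear [[q, q − 2δ − 2 − r', r', δ+2]]_q MDS subsystem code. -/
open scoped BigOperators

/-- The symplectic weight of a vector `(x|y) ∈ F_q^n × F_q^n`: the number of
coordinates `i` with `(x_i, y_i) ≠ (0,0)`. -/
noncomputable def swt {F : Type*} [Field F] {n : ℕ} (v : (Fin n → F) × (Fin n → F)) : ℕ :=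
  Nat.card {i : Fin n // ¬(v.1 i = 0 ∧ v.2 i = 0)}

/-- The minimum symplectic weight of the nonzero elements of a set `X`. -/
noncomputable def minSwt {F : Type*} [Field F] {n : ℕ}
    (X : Set ((Fin n → F) × (Fin n → F))) : ℕ :=
  sInf (swt '' {v ∈ X | v ≠ 0})

/-- The trace-symplectic form `⟨(a|b)|(a'|b')⟩ₛ = Tr_{F_q/F_p}(a'·b − a·b')`. -/
noncomputable def traceSymp (p : ℕ) {F : Type*} [Field F] [Algebra (ZMod p) F] {n : ℕ}
    (u w : (Fin n → F) × (Fin n → F)) : ZMod p :=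
  Algebra.trace (ZMod p) F (∑ i, (w.1 i * u.2 i - u.1 i * w.2 i))

/-- The trace-symplectic dual of a set `C ⊆ F_q^{2n}`. -/
def sdual (p : ℕ) {F : Type*} [Field F] [Algebra (ZMod p) F] {n : ℕ}
    (C : Set ((Fin n → F) × (Fin n → F))) : Set ((Fin n → F) × (Fin n → F)) :=
  {v | ∀ w ∈ C, traceSymp p v w = 0}

/-- `C` is (the additive code associated with) an `((n,K,R,d))_q` Clifford subsystem code:
with `D = C ∩ C^⊥s`, `|C| = q^n R / K`, `|D| = q^n/(KR)`, and `d = swt(D^⊥s − C)` if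
`C ≠ D^⊥s`, else `d = swt(D^⊥s)`. -/
def IsSubsysCode (p : ℕ) {F : Type*} [Field F] [Fintype F] [Algebra (ZMod p) F] {n : ℕ}
    (K R d : ℕ) (C : AddSubgroup ((Fin n → F) × (Fin n → F))) : Prop :=
  let S : Set ((Fin n → F) × (Fin n → F)) := ↑C
  let D : Set ((Fin n → F) × (Fin n → F)) := S ∩ sdual p S
  let Dp : Set ((Fin n → F) × (Fin n → F)) := sdual p D
  K * Nat.card C = Fintype.card F ^ n * R ∧
  K * R * Nat.card D = Fintype.card F ^ n ∧
  (S = Dp → d = minSwt Dp) ∧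
  (S ≠ Dp → d = minSwt (Dp \ S))

/-- `C` is (the linear code associated with) an `F_q`-linear `[[n,k,r,d]]_q` subsystem code. -/
def IsLinSubsysCode (p : ℕ) {F : Type*} [Field F] [Fintype F] [Algebra (ZMod p) F] {n : ℕ}
    (k r d : ℕ) (C : Submodule F ((Fin n → F) × (Fin n → F))) : Prop :=
  IsSubsysCode p (Fintype.card F ^ k) (Fintype.card F ^ r) d C.toAddSubgroup

/-- The vector of values, at the points enumerated by `e`, of the polynomial with coefficients
`c`. -/
noncomputable def evalCoeffs {F : Type*} [Field F] {n : ℕ} (e : Fin n ≃ F) :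
    (Fin n → F) →ₗ[F] (Fin n → F) where
  toFun c i := ∑ j, c j * e i ^ (j : ℕ)
  map_add' c d := by
    ext i
    simp [add_mul, Finset.sum_add_distrib]
  map_smul' a c := by
    ext i
    simp [Finset.mul_sum, mul_assoc]

/-- The vectors vanishing outside `I`. -/
def supportedOn (F : Type*) [Field F] {n : ℕ} (I : Finset (Fin n)) : Submodule F (Fin n → F) where
  carrier := {c | ∀ i ∉ I, c i = 0}
  add_mem' := fun hc hd i hi => by simp [hc i hi, hd i hi]
  zero_mem' := fun _ _ => rfl
  smul_mem' := fun a c hc i hi => by simp [hc i hi]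

/-- The evaluation code spanned by the monomials whose exponents lie in `I`. -/
noncomputable def monomialCode {F : Type*} [Field F] {n : ℕ} (e : Fin n ≃ F)
    (I : Finset (Fin n)) : Submodule F (Fin n → F) :=
  (supportedOn F I).map (evalCoeffs e)

section

variable {F : Type*} [Field F] {n : ℕ} (e : Fin n ≃ F)

lemma evalCoeffs_apply (c : Fin n → F) (i : Fin n) :
    evalCoeffs e c i = ∑ j, c j * e i ^ (j : ℕ) := rfl

open Polynomial in
lemma evalCoeffs_coeff (P : F[X]) (hP : P.natDegree < n) (i : Fin n) :
    evalCoeffs e (fun j => P.coeff j) i = P.eval (e i) := by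
  rw [evalCoeffs_apply, Polynomial.eval_eq_sum_range' hP,
    Fin.sum_univ_eq_sum_range (fun j => P.coeff j * e i ^ j)]

open Polynomial in
lemma exists_coeff_eq (c : Fin n → F) :
    ∃ P : F[X], (∀ j, n ≤ j → P.coeff j = 0) ∧ c = fun j : Fin n => P.coeff j := by
  refine ⟨∑ j : Fin n, monomial (j : ℕ) (c j), fun j hj => ?_, ?_⟩
  · rw [Polynomial.finsetSum_coeff]
    refine Finset.sum_eq_zero fun i _ => ?_
    rw [Polynomial.coeff_monomial, if_neg (by omega)]
  · ext j
    rw [Polynomial.finsetSum_coeff]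
    simp [Polynomial.coeff_monomial, Fin.val_inj]

open Polynomial in
/-- A nonzero polynomial of degree less than `m` has fewer than `m` zeros. -/
lemma card_zeros_evalCoeffs_lt {c : Fin n → F} (hc : c ≠ 0) {m : ℕ}
    (hm : ∀ i : Fin n, m ≤ i → c i = 0) [DecidableEq F] :
    (Finset.univ.filter fun i => evalCoeffs e c i = 0).card < m := by
  obtain ⟨P, hP, rfl⟩ := exists_coeff_eq c
  have hP0 : P ≠ 0 := by
    rintro rfl
    exact hc (by ext; simp)
  have hlt (j : ℕ) (hj : P.coeff j ≠ 0) : j < n ∧ j < m := by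
    have hjn : j < n := by
      by_contra! h
      exact hj (hP j h)
    refine ⟨hjn, ?_⟩
    by_contra! h
    exact hj (hm ⟨j, hjn⟩ h)
  obtain ⟨hdn, hdm⟩ := hlt P.natDegree (by simpa using hP0)
  refine lt_of_le_of_lt ?_ hdm
  rw [← Finset.card_map e.toEmbedding]
  refine Polynomial.card_le_degree_of_subset_roots fun x hx => ?_
  simp only [Finset.mem_val, Finset.mem_map, Finset.mem_filter, Finset.mem_univ, true_and] at hx
  obtain ⟨i, hi, rfl⟩ := hx
  rw [evalCoeffs_coeff e P hdn] at hi
  exact (Polynomial.mem_roots hP0).2 hi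

lemma evalCoeffs_injective : Function.Injective (evalCoeffs e) := by
  classical
  rw [injective_iff_map_eq_zero]
  intro c hc
  by_contra h
  have := card_zeros_evalCoeffs_lt e h (m := n) fun i hi => absurd i.2 (by omega)
  simp [hc] at this

lemma evalCoeffs_surjective : Function.Surjective (evalCoeffs e) :=
  LinearMap.surjective_of_injective (evalCoeffs_injective e)

lemma evalCoeffs_mem_monomialCode {I : Finset (Fin n)} {c : Fin n → F} :
    evalCoeffs e c ∈ monomialCode e I ↔ ∀ i ∉ I, c i = 0 :=
  (evalCoeffs_injective e).mem_set_image

lemma card_monomialCode (I : Finset (Fin n)) :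
    Nat.card (monomialCode e I) = n ^ I.card := by
  classical
  have h : supportedOn F I ≃ (I → F) :=
    { toFun := fun c i => c.1 i
      invFun := fun d => ⟨fun i => if h : i ∈ I then d ⟨i, h⟩ else 0, fun i hi => by simp [hi]⟩
      left_inv := fun c => by
        ext i
        by_cases hi : i ∈ I
        · simp [hi]
        · simp [hi, c.2 i hi]
      right_inv := fun d => by
        ext i
        simp }
  have h' : supportedOn F I ≃ monomialCode e I :=
    ((supportedOn F I).equivMapOfInjective _ (evalCoeffs_injective e)).toEquiv
  rw [← Nat.card_congr h', Nat.card_congr h, Nat.card_fun, ← Nat.card_congr e]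
  simp

lemma sum_pow_eq_ite [Fintype F] [DecidableEq F] {i : ℕ} (hi : i < 2 * (Fintype.card F - 1)) :
    ∑ x : F, x ^ i = if i + 1 = Fintype.card F then -1 else 0 := by
  have hq : 1 < Fintype.card F := Fintype.one_lt_card
  rcases lt_or_ge i (Fintype.card F - 1) with hlt | hge
  · rw [FiniteField.sum_pow_lt_card_sub_one F i hlt, if_neg (by omega)]
  have hunits := FiniteField.sum_pow_units F i
  have hdvd : Fintype.card F - 1 ∣ i ↔ i + 1 = Fintype.card F := by
    constructor
    · rintro ⟨t, rfl⟩
      have ht : t < 2 := by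
        rw [mul_comm 2] at hi
        exact lt_of_mul_lt_mul_left hi (Nat.zero_le _)
      interval_cases t <;> omega
    · intro h
      exact ⟨1, by omega⟩
  simp only [hdvd] at hunits
  rw [← hunits, ← Fintype.sum_subtype_add_sum_subtype (fun x : F => x ≠ 0) (fun x => x ^ i),
    ← unitsEquivNeZero.sum_comp, Fintype.sum_eq_zero (fun x : {x : F // ¬x ≠ 0} => (x : F) ^ i),
    add_zero]
  · rfl
  · intro x
    rw [not_not.1 x.2, zero_pow (by omega)]

/-- The bilinear form on evaluation vectors, in terms of coefficients. -/
lemma sum_evalCoeffs_mul (c d : Fin n → F) (hd : ∀ j : Fin n, (j : ℕ) + 1 = n → d j = 0) :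
    ∑ i, evalCoeffs e c i * evalCoeffs e d i = -∑ j, c j.rev * d j := by
  classical
  let _ : Fintype F := Fintype.ofEquiv _ e
  have hn : Fintype.card F = n := by simpa using (Fintype.card_congr e).symm
  have key (j : Fin n) : ∑ k, c k * d j * ∑ i, e i ^ ((k : ℕ) + j) = -(c j.rev * d j) := by
    by_cases hj : (j : ℕ) + 1 = n
    · simp [hd j hj]
    rw [Finset.sum_eq_single j.rev]
    · rw [e.sum_comp (fun x => x ^ ((j.rev : ℕ) + j)), sum_pow_eq_ite, if_pos]
      · ring
      · rw [hn, Fin.val_rev]; omega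
      · rw [hn, Fin.val_rev]; omega
    · intro k _ hk
      rw [e.sum_comp (fun x => x ^ ((k : ℕ) + j)), sum_pow_eq_ite, if_neg, mul_zero]
      · intro h
        refine hk (Fin.ext ?_)
        rw [Fin.val_rev]; omega
      · omega
    · simp
  rw [← Finset.sum_neg_distrib, ← Finset.sum_congr rfl fun j _ => key j]
  simp_rw [evalCoeffs_apply, Finset.sum_mul_sum, Finset.mul_sum]
  rw [Finset.sum_comm]
  conv_rhs => rw [Finset.sum_comm]
  refine Finset.sum_congr rfl fun k _ => ?_
  rw [Finset.sum_comm]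
  refine Finset.sum_congr rfl fun j _ => Finset.sum_congr rfl fun i _ => ?_
  ring

lemma forall_monomialCode_sum_mul_eq_zero_iff {I : Finset (Fin n)}
    (hI : ∀ j ∈ I, (j : ℕ) + 1 ≠ n) (c : Fin n → F) :
    (∀ w ∈ monomialCode e I, ∑ i, evalCoeffs e c i * w i = 0) ↔ ∀ j ∈ I, c j.rev = 0 := by
  classical
  constructor
  · intro h j hj
    have h1 := h (evalCoeffs e (Pi.single j 1)) ((evalCoeffs_mem_monomialCode e).2 fun i hi =>
      Pi.single_eq_of_ne (by rintro rfl; exact hi hj) _)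
    rw [sum_evalCoeffs_mul e c _ fun i hi =>
      Pi.single_eq_of_ne (by rintro rfl; exact hI _ hj hi) _] at h1
    simpa [Pi.single_apply] using h1
  · rintro h w ⟨d, hd, rfl⟩
    rw [sum_evalCoeffs_mul e c d fun j hj => hd j fun hjI => hI j hjI hj, neg_eq_zero]
    refine Finset.sum_eq_zero fun j _ => ?_
    by_cases hj : j ∈ I
    · simp [h j hj]
    · simp [hd j hj]

/-- For `F`-linear codes the trace can be dropped from the orthogonality condition. -/
lemma mem_sdual_prod_iff (p : ℕ) [Fact p.Prime] [Finite F] [Algebra (ZMod p) F]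
    (A B : Submodule F (Fin n → F)) (v : (Fin n → F) × (Fin n → F)) :
    v ∈ sdual p ((A.prod B : Submodule F _) : Set ((Fin n → F) × (Fin n → F))) ↔
      (∀ b ∈ B, ∑ i, v.1 i * b i = 0) ∧ ∀ a ∈ A, ∑ i, v.2 i * a i = 0 := by
  have nondeg (y : F) (hy : ∀ x : F, Algebra.trace (ZMod p) F (x * y) = 0) : y = 0 :=
    (traceForm_nondegenerate (ZMod p) F).2 y hy
  constructor
  · intro h
    refine ⟨fun b hb => nondeg _ fun x => ?_, fun a ha => nondeg _ fun x => ?_⟩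
    · have h1 := h (0, x • b) ⟨A.zero_mem, B.smul_mem x hb⟩
      simp only [traceSymp, Pi.zero_apply, zero_mul, zero_sub, Finset.sum_neg_distrib, map_neg,
        neg_eq_zero, Pi.smul_apply, smul_eq_mul] at h1
      rw [← h1, Finset.mul_sum]
      exact congrArg _ (Finset.sum_congr rfl fun i _ => by ring)
    · have h1 := h (x • a, 0) ⟨A.smul_mem x ha, B.zero_mem⟩
      simp only [traceSymp, Pi.zero_apply, mul_zero, sub_zero, Pi.smul_apply, smul_eq_mul] at h1
      rw [← h1, Finset.mul_sum]
      exact congrArg _ (Finset.sum_congr rfl fun i _ => by ring)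
  · rintro ⟨h1, h2⟩ w ⟨ha, hb⟩
    rw [traceSymp, Finset.sum_sub_distrib, h1 _ hb]
    simp_rw [mul_comm (w.1 _)]
    rw [h2 _ ha, sub_zero, map_zero]

lemma mem_sdual_monomialCode_prod_iff (p : ℕ) [Fact p.Prime] [Finite F] [Algebra (ZMod p) F]
    {I J : Finset (Fin n)} (hI : ∀ j ∈ I, (j : ℕ) + 1 ≠ n) (hJ : ∀ j ∈ J, (j : ℕ) + 1 ≠ n)
    (a b : Fin n → F) :
    (evalCoeffs e a, evalCoeffs e b) ∈ sdual p
      (((monomialCode e I).prod (monomialCode e J) : Submodule F _) :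
        Set ((Fin n → F) × (Fin n → F))) ↔
      (∀ j ∈ J, a j.rev = 0) ∧ ∀ j ∈ I, b j.rev = 0 := by
  rw [mem_sdual_prod_iff, forall_monomialCode_sum_mul_eq_zero_iff e hJ,
    forall_monomialCode_sum_mul_eq_zero_iff e hI]

lemma exists_evalCoeffs_pair_eq (v : (Fin n → F) × (Fin n → F)) :
    ∃ a b, v = (evalCoeffs e a, evalCoeffs e b) := by
  obtain ⟨a, ha⟩ := evalCoeffs_surjective e v.1
  obtain ⟨b, hb⟩ := evalCoeffs_surjective e v.2
  exact ⟨a, b, by rw [ha, hb]⟩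

lemma sdual_monomialCode_prod (p : ℕ) [Fact p.Prime] [Finite F] [Algebra (ZMod p) F]
    {I J I' J' : Finset (Fin n)} (hI : ∀ j ∈ I, (j : ℕ) + 1 ≠ n) (hJ : ∀ j ∈ J, (j : ℕ) + 1 ≠ n)
    (hI' : ∀ j, j ∈ I' ↔ j.rev ∉ J) (hJ' : ∀ j, j ∈ J' ↔ j.rev ∉ I) :
    sdual p (((monomialCode e I).prod (monomialCode e J) : Submodule F _) :
        Set ((Fin n → F) × (Fin n → F))) =
      ((monomialCode e I').prod (monomialCode e J') : Submodule F _) := by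
  ext v
  obtain ⟨a, b, rfl⟩ := exists_evalCoeffs_pair_eq e v
  rw [mem_sdual_monomialCode_prod_iff e p hI hJ, SetLike.mem_coe, Submodule.mem_prod,
    evalCoeffs_mem_monomialCode, evalCoeffs_mem_monomialCode]
  simp only [hI', hJ', not_not]
  exact and_congr (Fin.revPerm.forall_congr fun j => by simp)
    (Fin.revPerm.forall_congr fun j => by simp)

lemma monomialCode_inf (I J : Finset (Fin n)) :
    monomialCode e I ⊓ monomialCode e J = monomialCode e (I ∩ J) := by
  ext v
  obtain ⟨a, rfl⟩ := evalCoeffs_surjective e v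
  simp only [Submodule.mem_inf, evalCoeffs_mem_monomialCode, Finset.mem_inter]
  grind

lemma monomialCode_mono {I J : Finset (Fin n)} (h : I ⊆ J) :
    monomialCode e I ≤ monomialCode e J := by
  rintro _ ⟨c, hc, rfl⟩
  exact ⟨c, fun i hi => hc i fun hi' => hi (h hi'), rfl⟩

lemma card_monomialCode_prod (I J : Finset (Fin n)) :
    Nat.card ((monomialCode e I).prod (monomialCode e J)) = n ^ (I.card + J.card) := by
  have h := Nat.card_congr ((monomialCode e I).toAddSubgroup.prodEquiv
    (monomialCode e J).toAddSubgroup).toEquiv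
  rw [Nat.card_prod] at h
  refine h.trans ?_
  change Nat.card (monomialCode e I) * Nat.card (monomialCode e J) = _
  rw [ card_monomialCode, card_monomialCode, pow_add]

/-- The Singleton-type weight bound for the codes of polynomials of degree less than `m`. -/
lemma lt_swt_add {m : ℕ} {I : Finset (Fin n)} (hI : ∀ i ∈ I, (i : ℕ) < m)
    {v : (Fin n → F) × (Fin n → F)} (hv : v ∈ (monomialCode e I).prod (monomialCode e I))
    (hv0 : v ≠ 0) : n < swt v + m := by
  classical
  obtain ⟨a, b, rfl⟩ := exists_evalCoeffs_pair_eq e v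
  simp only [Submodule.mem_prod, evalCoeffs_mem_monomialCode] at hv
  rw [swt, Nat.card_eq_fintype_card, Fintype.card_subtype]
  have hcard := Finset.card_filter_add_card_filter_not (s := (Finset.univ : Finset (Fin n)))
    fun i => evalCoeffs e a i = 0 ∧ evalCoeffs e b i = 0
  rw [Finset.card_univ, Fintype.card_fin] at hcard
  suffices h : (Finset.univ.filter
      fun i => evalCoeffs e a i = 0 ∧ evalCoeffs e b i = 0).card < m by
    dsimp only
    omega
  have hvan {c : Fin n → F} (hc : ∀ i ∉ I, c i = 0) (i : Fin n) (hi : m ≤ i) : c i = 0 :=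
    hc i fun h => absurd (hI i h) (by omega)
  by_cases ha : a = 0
  · have hb : b ≠ 0 := by
      rintro rfl
      exact hv0 (by simp [ha])
    exact (Finset.card_le_card (Finset.monotone_filter_right _ fun i _ h => h.2)).trans_lt
      (card_zeros_evalCoeffs_lt e hb (hvan hv.2))
  · exact (Finset.card_le_card (Finset.monotone_filter_right _ fun i _ h => h.1)).trans_lt
      (card_zeros_evalCoeffs_lt e ha (hvan hv.1))

open Polynomial in
/-- For each `m < n` some monic polynomial of degree `m` has `m` distinct zeros. -/
lemma exists_swt_evalCoeffs_le {m : ℕ} (hm : m < n) :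
    ∃ c : Fin n → F, c ⟨m, hm⟩ = 1 ∧ (∀ i : Fin n, m < i → c i = 0) ∧
      swt (evalCoeffs e c, 0) + m ≤ n := by
  classical
  obtain ⟨s, -, hs⟩ := Finset.exists_subset_card_eq (s := (Finset.univ : Finset (Fin n)))
    (n := m) (by simpa using hm.le)
  set P : F[X] := ∏ i ∈ s, (X - C (e i)) with hPdef
  have hmonic : P.Monic := Polynomial.monic_prod_X_sub_C _ _
  have hdeg : P.natDegree = m := by
    rw [hPdef, Polynomial.natDegree_finsetProd_X_sub_C_eq_card, hs]
  refine ⟨fun j => P.coeff j, ?_, fun i hi => ?_, ?_⟩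
  · have := hmonic.coeff_natDegree
    rwa [hdeg] at this
  · exact Polynomial.coeff_eq_zero_of_natDegree_lt (by omega)
  · rw [swt, Nat.card_eq_fintype_card, Fintype.card_subtype]
    have hsub : (Finset.univ.filter fun i => ¬(evalCoeffs e (fun j => P.coeff j) i = 0 ∧
        (0 : Fin n → F) i = 0)) ⊆ sᶜ := by
      intro i hi
      rw [Finset.mem_compl]
      intro his
      rw [Finset.mem_filter] at hi
      refine hi.2 ⟨?_, rfl⟩
      rw [evalCoeffs_coeff e P (by omega), hPdef, Polynomial.eval_prod]
      exact Finset.prod_eq_zero his (by simp)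
    have h1 := Finset.card_le_card hsub
    rw [Finset.card_compl, Fintype.card_fin, hs] at h1
    dsimp only
    omega

end

lemma le_minSwt {F : Type*} [Field F] {n d : ℕ} {X : Set ((Fin n → F) × (Fin n → F))}
    (hX : ∃ v ∈ X, v ≠ 0) (h : ∀ v ∈ X, v ≠ 0 → d ≤ swt v) : d ≤ minSwt X := by
  obtain ⟨v, hv, hv0⟩ := hX
  refine le_csInf ⟨_, v, ⟨hv, hv0⟩, rfl⟩ ?_
  rintro _ ⟨w, hw, rfl⟩
  exact h w hw.1 hw.2

lemma card_filter_fin {n : ℕ} (s : Finset ℕ) (hs : ∀ i ∈ s, i < n) :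
    (Finset.univ.filter fun i : Fin n => (i : ℕ) ∈ s).card = s.card := by
  rw [← Finset.card_map Fin.valEmbedding]
  congr 1
  ext i
  simp only [Finset.mem_map, Finset.mem_filter, Finset.mem_univ, true_and, Fin.valEmbedding_apply]
  exact ⟨fun ⟨j, hj, h⟩ => h ▸ hj, fun h => ⟨⟨i, hs i h⟩, h, rfl⟩⟩

/-- For all `0 ≤ δ < (q-1)/2` and `0 ≤ r' < q - 2δ - 2`, there exists a pure
`F_q`-linear `[[q, q - 2δ - 2 - r', r', δ+2]]_q` MDS subsystem code. -/
theorem stmt_9 (p m : ℕ) [Fact p.Prime] (hm : 0 < m)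
    (F : Type) [Field F] [Fintype F] [Algebra (ZMod p) F]
    (hq : Fintype.card F = p ^ m) :
    ∀ δ r' : ℕ, 2 * δ + 1 < Fintype.card F → r' + 2 * δ + 2 < Fintype.card F →
      ∃ k, k + r' + 2 * δ + 2 = Fintype.card F ∧
        ∃ C : Submodule F ((Fin (Fintype.card F) → F) × (Fin (Fintype.card F) → F)),
          IsLinSubsysCode p k r' (δ + 2) C ∧
          δ + 2 ≤ minSwt (C : Set ((Fin (Fintype.card F) → F) ×
            (Fin (Fintype.card F) → F))) := by
  intro δ r' _ hr
  obtain ⟨e⟩ : Nonempty (Fin (Fintype.card F) ≃ F) := ⟨(Fintype.equivFin F).symm⟩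
  obtain ⟨k, hk⟩ : ∃ k, k + r' + 2 * δ + 2 = Fintype.card F :=
    ⟨Fintype.card F - (r' + 2 * δ + 2), by omega⟩
  refine ⟨k, hk, ?_⟩
  have h1 : 1 < Fintype.card F := Fintype.one_lt_card
  generalize hn : Fintype.card F = n at *
  let exps (s : Finset ℕ) : Finset (Fin n) := Finset.univ.filter fun i => (i : ℕ) ∈ s
  have mem_exps (s : Finset ℕ) (i : Fin n) : i ∈ exps s ↔ (i : ℕ) ∈ s := by simp [exps]
  have card_exps (s : Finset ℕ) (hs : ∀ i ∈ s, i < n) : (exps s).card = s.card :=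
    card_filter_fin s hs
  let I := exps (Finset.range (δ + 1 + r'))
  let J := exps (Finset.range (δ + 1) ∪ Finset.Ico (n - 1 - δ - r') (n - 1 - δ))
  let L := exps (Finset.range (δ + 1))
  let M := exps (Finset.range (n - δ - 1))
  have mem_I (i : Fin n) : i ∈ I ↔ (i : ℕ) < δ + 1 + r' := by simp [I, mem_exps]
  have mem_J (i : Fin n) : i ∈ J ↔ (i : ℕ) < δ + 1 ∨ n - 1 - δ - r' ≤ i ∧ (i : ℕ) < n - 1 - δ := by
    simp only [J, mem_exps, Finset.mem_union, Finset.mem_range, Finset.mem_Ico]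
  have mem_L (i : Fin n) : i ∈ L ↔ (i : ℕ) < δ + 1 := by simp [L, mem_exps]
  have mem_M (i : Fin n) : i ∈ M ↔ (i : ℕ) < n - δ - 1 := by simp [M, mem_exps]
  have card_I : I.card = δ + 1 + r' := by
    rw [card_exps _ fun i hi => by rw [Finset.mem_range] at hi; omega, Finset.card_range]
  have card_J : J.card = δ + 1 + r' := by
    rw [card_exps, Finset.card_union_of_disjoint, Finset.card_range, Nat.card_Ico]
    · omega
    · rw [Finset.disjoint_left]
      intro i
      rw [Finset.mem_range, Finset.mem_Ico]
      omega
    · intro i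
      rw [Finset.mem_union, Finset.mem_range, Finset.mem_Ico]
      omega
  have card_L : L.card = δ + 1 := by
    rw [card_exps _ fun i hi => by rw [Finset.mem_range] at hi; omega, Finset.card_range]
  have hIM : I ⊆ M := fun i => by rw [mem_I, mem_M]; omega
  have hJM : J ⊆ M := fun i => by rw [mem_J, mem_M]; omega
  let C : Submodule F ((Fin n → F) × (Fin n → F)) := (monomialCode e I).prod (monomialCode e J)
  let E : Submodule F ((Fin n → F) × (Fin n → F)) := (monomialCode e L).prod (monomialCode e L)
  let E' : Submodule F ((Fin n → F) × (Fin n → F)) := (monomialCode e M).prod (monomialCode e M)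
  have hCE' : C ≤ E' := Submodule.prod_mono (monomialCode_mono e hIM) (monomialCode_mono e hJM)
  have hD : (C : Set ((Fin n → F) × (Fin n → F))) ∩ sdual p C = E := by
    rw [sdual_monomialCode_prod e p (I' := Finset.univ.filter fun j => j.rev ∉ J)
      (J' := Finset.univ.filter fun j => j.rev ∉ I)
      (fun j hj => by rw [mem_I] at hj; omega) (fun j hj => by rw [mem_J] at hj; omega)
      (by simp) (by simp), ← Submodule.coe_inf, Submodule.prod_inf_prod, monomialCode_inf,
      monomialCode_inf]
    have hI : I ∩ (Finset.univ.filter fun j => j.rev ∉ J) = L := by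
      ext i
      simp only [Finset.mem_inter, Finset.mem_filter, Finset.mem_univ, true_and, mem_I, mem_J,
        mem_L, Fin.val_rev]
      omega
    have hJ : J ∩ (Finset.univ.filter fun j => j.rev ∉ I) = L := by
      ext i
      simp only [Finset.mem_inter, Finset.mem_filter, Finset.mem_univ, true_and, mem_I, mem_J,
        mem_L, Fin.val_rev]
      omega
    rw [hI, hJ]
  have hDp : sdual p (E : Set ((Fin n → F) × (Fin n → F))) = E' :=
    sdual_monomialCode_prod e p (fun j hj => by rw [mem_L] at hj; omega)
      (fun j hj => by rw [mem_L] at hj; omega)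
      (fun j => by rw [mem_L, mem_M, Fin.val_rev]; omega)
      (fun j => by rw [mem_L, mem_M, Fin.val_rev]; omega)
  have hwt (v : (Fin n → F) × (Fin n → F)) (hv : v ∈ E') (hv0 : v ≠ 0) : δ + 2 ≤ swt v := by
    have := lt_swt_add e (fun i hi => (mem_M i).1 hi) hv hv0
    omega
  obtain ⟨c, hc1, hc, hcwt⟩ := exists_swt_evalCoeffs_le e (m := n - δ - 2) (by omega)
  have hcE' : (evalCoeffs e c, 0) ∈ E' := by
    refine ⟨(evalCoeffs_mem_monomialCode e).2 fun i hi => hc i ?_, Submodule.zero_mem _⟩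
    rw [mem_M] at hi
    omega
  have hcC : (evalCoeffs e c, 0) ∉ C := fun h => by
    have := (evalCoeffs_mem_monomialCode e).1 h.1 ⟨n - δ - 2, by omega⟩
      (by rw [mem_I]; dsimp only; omega)
    rw [hc1] at this
    exact one_ne_zero this
  have hc0 : (evalCoeffs e c, (0 : Fin n → F)) ≠ 0 := fun h => hcC (h ▸ C.zero_mem)
  have cardC : Nat.card C = n ^ (I.card + J.card) := card_monomialCode_prod e I J
  have cardE : Nat.card E = n ^ (L.card + L.card) := card_monomialCode_prod e L L
  refine ⟨C, ⟨?_, ?_, fun h => ?_, fun _ => ?_⟩, ?_⟩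
  · change _ * Nat.card C = _
    rw [cardC, hn, ← pow_add, ← pow_add, card_I, card_J]
    congr 1
    omega
  · change _ * Nat.card ((C : Set ((Fin n → F) × (Fin n → F))) ∩ sdual p C : Set _) = _
    rw [hD]
    change _ * Nat.card E = _
    rw [cardE, hn, ← pow_add, ← pow_add, card_L]
    congr 1
    omega
  · change (C : Set ((Fin n → F) × (Fin n → F))) = sdual p (C ∩ sdual p C) at h
    rw [hD, hDp] at h
    exact absurd (h.ge hcE') hcC
  · change _ = minSwt (sdual p (C ∩ sdual p C) \ (C : Set ((Fin n → F) × (Fin n → F))))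
    rw [hD, hDp]
    refine le_antisymm (le_minSwt ⟨_, ⟨hcE', hcC⟩, hc0⟩ fun v hv hv0 => hwt v hv.1 hv0) ?_
    refine (Nat.sInf_le (m := swt (evalCoeffs e c, 0)) ?_).trans (by omega)
    exact ⟨_, ⟨⟨hcE', hcC⟩, hc0⟩, rfl⟩
  · refine le_minSwt ?_ fun v hv hv0 => hwt v (hCE' hv) hv0
    by_contra! h
    have hbot : C = ⊥ := (Submodule.eq_bot_iff C).2 h
    have : 1 < Nat.card C := by
      rw [cardC, card_I]
      exact Nat.one_lt_pow (by omega) h1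
    rw [hbot] at this
    simp at this
end

section
/- If there exists a pure [[n₁, k₁, r₁, d₁]]₂ subsystem code and a pure [[n₂, k₂, r₂, d₂]]₂ subsystem code such that k₂ + r₂ ≤ n₁, then for every r in the range 0 ≤ r < k₁ + r₁ there exists an [[n₁ + n₂ − k₂ − r₂, k₁ + r₁ − r, r, d]]₂ subsystem code whose minimum distance satisfies d ≥ min{d₁, d₁ + d₂ − k₂ − r₂}. -/
open scoped BigOperators

section SymplecticLinearAlgebra

open Module
open LinearMap (BilinForm)

variable {F : Type*} [Field F] {a b n m : ℕ}

/-- The standard symplectic space `F^n × F^n`. -/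
abbrev SympSpace (F : Type*) (n : ℕ) := (Fin n → F) × (Fin n → F)

/-- The standard symplectic form on `F^n × F^n`. -/
def sympForm (F : Type*) [Field F] (n : ℕ) : BilinForm F (SympSpace F n) :=
  LinearMap.mk₂ F (fun u w => ∑ i, (w.1 i * u.2 i - u.1 i * w.2 i))
    (fun x y z => by
      rw [← Finset.sum_add_distrib]
      refine Finset.sum_congr rfl fun i _ => ?_
      simp only [Prod.fst_add, Prod.snd_add, Pi.add_apply]
      ring)
    (fun c x z => by
      rw [Finset.smul_sum]
      refine Finset.sum_congr rfl fun i _ => ?_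
      simp only [Prod.smul_fst, Prod.smul_snd, Pi.smul_apply, smul_eq_mul]
      ring)
    (fun x y z => by
      rw [← Finset.sum_add_distrib]
      refine Finset.sum_congr rfl fun i _ => ?_
      simp only [Prod.fst_add, Prod.snd_add, Pi.add_apply]
      ring)
    (fun c x z => by
      rw [Finset.smul_sum]
      refine Finset.sum_congr rfl fun i _ => ?_
      simp only [Prod.smul_fst, Prod.smul_snd, Pi.smul_apply, smul_eq_mul]
      ring)

theorem sympForm_apply (u w : SympSpace F n) :
    sympForm F n u w = ∑ i, (w.1 i * u.2 i - u.1 i * w.2 i) := rfl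

theorem sympForm_isAlt : (sympForm F n).IsAlt := fun u => by
  simp [sympForm_apply]

theorem eq_zero_of_sympForm_eq_zero {u : SympSpace F n} (h : ∀ w, sympForm F n u w = 0) :
    u = 0 := by
  classical
  ext i
  · simpa [sympForm_apply, Pi.single_apply] using h (0, Pi.single i 1)
  · simpa [sympForm_apply, Pi.single_apply] using h (Pi.single i 1, 0)

theorem sympForm_nondegenerate : (sympForm F n).Nondegenerate :=
  ⟨fun _ h => eq_zero_of_sympForm_eq_zero h, fun _ h => eq_zero_of_sympForm_eq_zero fun w =>
    sympForm_isAlt.eq_iff.1 (h w)⟩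

theorem finrank_sympSpace : finrank F (SympSpace F n) = 2 * n := by
  simp [two_mul]

/-- Juxtaposition of coordinates, `F^{2a} × F^{2b} ≃ F^{2(a+b)}`. -/
def glue (F : Type*) [Field F] (a b : ℕ) :
    (SympSpace F a × SympSpace F b) ≃ₗ[F] SympSpace F (a + b) where
  toFun p := (Fin.append p.1.1 p.2.1, Fin.append p.1.2 p.2.2)
  invFun z := ((fun i => z.1 (Fin.castAdd b i), fun i => z.2 (Fin.castAdd b i)),
    (fun i => z.1 (Fin.natAdd a i), fun i => z.2 (Fin.natAdd a i)))
  map_add' p q := by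
    ext i <;> refine Fin.addCases (fun j => ?_) (fun j => ?_) i <;> simp
  map_smul' c p := by
    ext i <;> refine Fin.addCases (fun j => ?_) (fun j => ?_) i <;> simp
  left_inv p := by simp
  right_inv z := by
    ext i <;> refine Fin.addCases (fun j => ?_) (fun j => ?_) i <;> simp

theorem sympForm_glue (p q : SympSpace F a × SympSpace F b) :
    sympForm F (a + b) (glue F a b p) (glue F a b q) =
      sympForm F a p.1 q.1 + sympForm F b p.2 q.2 := by
  simp only [sympForm_apply, glue, Fin.sum_univ_add, LinearEquiv.coe_mk, LinearMap.coe_mk,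
    AddHom.coe_mk, Fin.append_left, Fin.append_right]

theorem swt_eq_sum [DecidableEq F] (v : SympSpace F n) :
    swt v = ∑ i, if v.1 i = 0 ∧ v.2 i = 0 then 0 else 1 := by
  rw [swt, Nat.card_eq_fintype_card, Fintype.card_subtype, Finset.card_filter]
  exact Finset.sum_congr rfl fun i _ => by split_ifs <;> simp_all

theorem swt_le (v : SympSpace F n) : swt v ≤ n := by
  simpa [swt] using Finite.card_subtype_le (fun i => ¬(v.1 i = 0 ∧ v.2 i = 0))

theorem swt_zero : swt (0 : SympSpace F n) = 0 := by simp [swt]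

theorem swt_glue (p : SympSpace F a × SympSpace F b) :
    swt (glue F a b p) = swt p.1 + swt p.2 := by
  classical
  simp [swt_eq_sum, glue, Fin.sum_univ_add]

/-- Every alternating form is the pullback of a standard symplectic form along a surjection. -/
theorem LinearMap.BilinForm.IsAlt.exists_surjective_isometry {W : Type*} [AddCommGroup W]
    [Module F W] [FiniteDimensional F W] {B : BilinForm F W} (hB : B.IsAlt) :
    ∃ (m : ℕ) (ρ : W →ₗ[F] SympSpace F m), Function.Surjective ρ ∧
      ∀ x y, sympForm F m (ρ x) (ρ y) = B x y := by
  induction hk : finrank F W - finrank F (LinearMap.ker B) using Nat.strong_induction_on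
    generalizing B with
  | _ k ih =>
  by_cases h0 : B = 0
  · refine ⟨0, 0, fun y => ⟨0, Subsingleton.elim _ _⟩, fun x y => ?_⟩
    simp [h0]
  obtain ⟨e, f, hef⟩ : ∃ e f, B e f = 1 := by
    by_contra! h
    refine h0 (LinearMap.ext₂ fun x y => ?_)
    by_contra hxy
    refine h x ((B x y)⁻¹ • y) ?_
    rw [map_smul, smul_eq_mul, inv_mul_cancel₀ hxy]
  have hee : B e e = 0 := hB e
  have hff : B f f = 0 := hB f
  have hskew : ∀ x y, B x y = -B y x := fun x y => (LinearMap.IsAlt.neg hB y x).symm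
  let φ : W →ₗ[F] F := B e
  let ψ : W →ₗ[F] F := B.flip f
  let B' : BilinForm F W := B - (BilinForm.linMulLin ψ φ - BilinForm.linMulLin φ ψ)
  have hB' : ∀ x y, B' x y = B x y - (B x f * B e y - B e x * B y f) := fun x y => rfl
  have hB'alt : B'.IsAlt := fun x => by rw [hB', hB x]; ring
  have hker : LinearMap.ker B < LinearMap.ker B' := by
    refine lt_of_le_of_ne (fun x hx => ?_) fun h => ?_
    · rw [LinearMap.mem_ker] at hx ⊢
      ext y
      rw [hB', hskew e x, hx]
      simp
    · have he : e ∈ LinearMap.ker B' := by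
        rw [LinearMap.mem_ker]
        ext y
        rw [hB', hef, hee]
        simp
      rw [← h, LinearMap.mem_ker] at he
      simp [he] at hef
  obtain ⟨m, ρ, hsurj, hiso⟩ := ih _ (by
    have h1 := Submodule.finrank_lt_finrank_of_lt hker
    have h2 := Submodule.finrank_le (LinearMap.ker B')
    omega) hB'alt rfl
  have hρe : ρ e = 0 := eq_zero_of_sympForm_eq_zero fun w => by
    obtain ⟨y, rfl⟩ := hsurj w
    rw [hiso, hB', hef, hee]
    ring
  have hρf : ρ f = 0 := eq_zero_of_sympForm_eq_zero fun w => by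
    obtain ⟨y, rfl⟩ := hsurj w
    rw [hiso, hB', hef, hff, hskew f y]
    ring
  let σ : W →ₗ[F] SympSpace F 1 := (LinearMap.pi fun _ => φ).prod (LinearMap.pi fun _ => ψ)
  have hσ : ∀ x, σ x = (fun _ => B e x, fun _ => B x f) := fun x => rfl
  refine ⟨1 + m, (glue F 1 m).toLinearMap ∘ₗ σ.prod ρ, fun z => ?_, fun x y => ?_⟩
  · obtain ⟨⟨s, w⟩, rfl⟩ := (glue F 1 m).surjective z
    obtain ⟨x, rfl⟩ := hsurj w
    refine ⟨x + (s.2 0 - B x f) • e + (s.1 0 - B e x) • f, ?_⟩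
    refine congrArg (glue F 1 m) (Prod.ext ?_ ?_)
    · change σ _ = s
      rw [hσ]
      ext i <;> rw [Subsingleton.elim i 0] <;> simp [hee, hff, hef]
    · simp [hρe, hρf]
  · change sympForm F (1 + m) (glue F 1 m (σ x, ρ x)) (glue F 1 m (σ y, ρ y)) = _
    rw [sympForm_glue, hiso, hB', hσ, hσ]
    simp [sympForm_apply]
    ring

/-- `ρ` restricts to a surjective isometry from the coisotropic subspace `E` onto `F^{2m}`, and
so identifies `E / E^⊥` with `F^{2m}`. -/
structure IsSymplecticReduction (E : Submodule F (SympSpace F n))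
    (ρ : SympSpace F n →ₗ[F] SympSpace F m) : Prop where
  orthogonal_le : (sympForm F n).orthogonal E ≤ E
  exists_mem_eq : ∀ t, ∃ x ∈ E, ρ x = t
  isometry : ∀ x ∈ E, ∀ y ∈ E, sympForm F m (ρ x) (ρ y) = sympForm F n x y

namespace IsSymplecticReduction

variable {E : Submodule F (SympSpace F n)} {ρ : SympSpace F n →ₗ[F] SympSpace F m}

theorem mem_orthogonal_iff (h : IsSymplecticReduction E ρ) {x : SympSpace F n} :
    x ∈ (sympForm F n).orthogonal E ↔ x ∈ E ∧ ρ x = 0 := by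
  refine ⟨fun hx => ⟨h.orthogonal_le hx, eq_zero_of_sympForm_eq_zero fun w => ?_⟩,
    fun ⟨hx, hρ⟩ y hy => ?_⟩
  · obtain ⟨y, hy, rfl⟩ := h.exists_mem_eq w
    rw [h.isometry x (h.orthogonal_le hx) y hy]
    exact sympForm_isAlt.eq_iff.1 (hx y hy)
  · change sympForm F n y x = 0
    rw [← h.isometry y hy x hx, hρ, map_zero]

theorem orthogonal_le_inf_comap (h : IsSymplecticReduction E ρ)
    (S : Submodule F (SympSpace F m)) : (sympForm F n).orthogonal E ≤ E ⊓ S.comap ρ :=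
  fun x hx => by
    obtain ⟨hxE, hx0⟩ := h.mem_orthogonal_iff.1 hx
    exact ⟨hxE, by simp [hx0]⟩

theorem finrank_inf_comap (h : IsSymplecticReduction E ρ) (S : Submodule F (SympSpace F m)) :
    finrank F ↥(E ⊓ S.comap ρ) =
      finrank F S + finrank F ((sympForm F n).orthogonal E) := by
  rw [← LinearMap.finrank_range_add_finrank_ker (ρ.domRestrict (E ⊓ S.comap ρ))]
  congr 1
  · have : LinearMap.range (ρ.domRestrict (E ⊓ S.comap ρ)) = S := by
      ext t
      constructor
      · rintro ⟨x, rfl⟩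
        exact x.2.2
      · intro ht
        obtain ⟨x, hx, rfl⟩ := h.exists_mem_eq t
        exact ⟨⟨x, hx, ht⟩, rfl⟩
    rw [this]
  · rw [← (Submodule.comapSubtypeEquivOfLe (h.orthogonal_le_inf_comap S)).finrank_eq]
    have : LinearMap.ker (ρ.domRestrict (E ⊓ S.comap ρ)) =
        ((sympForm F n).orthogonal E).comap (E ⊓ S.comap ρ).subtype := by
      ext x
      rw [Submodule.mem_comap, h.mem_orthogonal_iff]
      exact ⟨fun hx => ⟨x.2.1, hx⟩, fun hx => hx.2⟩
    rw [this]

theorem finrank_orthogonal_add (h : IsSymplecticReduction E ρ) :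
    finrank F ((sympForm F n).orthogonal E) + m = n := by
  have h1 := h.finrank_inf_comap ⊤
  rw [Submodule.comap_top, inf_top_eq, finrank_top, finrank_sympSpace] at h1
  have h2 := BilinForm.finrank_orthogonal sympForm_nondegenerate E
  rw [finrank_sympSpace] at h2
  have h3 := Submodule.finrank_le E
  rw [finrank_sympSpace] at h3
  omega

/-- Gluing two reductions along `b` of the `a + b` coordinates of the first one. -/
theorem exists_glue {E₁ : Submodule F (SympSpace F (a + b))}
    {ρ₁ : SympSpace F (a + b) →ₗ[F] SympSpace F m} (h₁ : IsSymplecticReduction E₁ ρ₁)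
    {E₂ : Submodule F (SympSpace F n)} {ρ₂ : SympSpace F n →ₗ[F] SympSpace F b}
    (h₂ : IsSymplecticReduction E₂ ρ₂) {d₁ d₂ : ℕ}
    (hd₁ : ∀ x ∈ E₁, x ≠ 0 → d₁ ≤ swt x) (hd₂ : ∀ x ∈ E₂, x ≠ 0 → d₂ ≤ swt x) :
    ∃ (E : Submodule F (SympSpace F (a + n)))
      (ρ : SympSpace F (a + n) →ₗ[F] SympSpace F m), IsSymplecticReduction E ρ ∧
      ∀ x ∈ E, ρ x ≠ 0 → min (d₁ : ℤ) (d₁ + d₂ - b) ≤ swt x := by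
  let P : SympSpace F (a + n) →ₗ[F] SympSpace F a :=
    LinearMap.fst F _ _ ∘ₗ (glue F a n).symm.toLinearMap
  let Q : SympSpace F (a + n) →ₗ[F] SympSpace F n :=
    LinearMap.snd F _ _ ∘ₗ (glue F a n).symm.toLinearMap
  let T : SympSpace F (a + n) →ₗ[F] SympSpace F (a + b) :=
    (glue F a b).toLinearMap ∘ₗ P.prod (ρ₂ ∘ₗ Q)
  have hQ : ∀ u v, Q (glue F a n (u, v)) = v := fun u v => by simp [Q]
  have hT : ∀ u v, T (glue F a n (u, v)) = glue F a b (u, ρ₂ v) :=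
    fun u v => by simp [T, P, Q]
  let E : Submodule F (SympSpace F (a + n)) := E₂.comap Q ⊓ E₁.comap T
  have hE : ∀ u v, glue F a n (u, v) ∈ E ↔
      v ∈ E₂ ∧ glue F a b (u, ρ₂ v) ∈ E₁ := fun u v => by
    rw [← hT u v]
    nth_rewrite 2 [← hQ u v]
    rfl
  have lift : ∀ y ∈ E₁, ∃ u, ∃ v ∈ E₂, glue F a b (u, ρ₂ v) = y := fun y _ => by
    obtain ⟨⟨u, w⟩, rfl⟩ := (glue F a b).surjective y
    obtain ⟨v, hv, rfl⟩ := h₂.exists_mem_eq w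
    exact ⟨u, v, hv, rfl⟩
  refine ⟨E, ρ₁ ∘ₗ T, ⟨fun z hz => ?_, fun t => ?_, fun x hx y hy => ?_⟩, fun x hx hρ => ?_⟩
  · obtain ⟨⟨u, v⟩, rfl⟩ := (glue F a n).surjective z
    have hz' : ∀ u' v', v' ∈ E₂ → glue F a b (u', ρ₂ v') ∈ E₁ →
        sympForm F a u' u + sympForm F n v' v = 0 := fun u' v' hv' hE' => by
      have := hz _ ((hE u' v').2 ⟨hv', hE'⟩)
      rwa [sympForm_glue] at this
    have hv : v ∈ E₂ := by
      rw [← BilinForm.orthogonal_orthogonal sympForm_nondegenerate sympForm_isAlt.isRefl E₂]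
      intro v' hv'
      obtain ⟨hvE', hv0'⟩ := h₂.mem_orthogonal_iff.1 hv'
      have := hz' 0 v' hvE' (by rw [hv0', ← Prod.zero_eq_mk, map_zero]; exact E₁.zero_mem)
      simpa using this
    refine (hE u v).2 ⟨hv, h₁.orthogonal_le fun y hy => ?_⟩
    obtain ⟨u', v', hv', rfl⟩ := lift y hy
    rw [sympForm_glue, h₂.isometry v' hv' v hv]
    exact hz' u' v' hv' hy
  · obtain ⟨y, hy, rfl⟩ := h₁.exists_mem_eq t
    obtain ⟨u, v, hv, rfl⟩ := lift y hy
    exact ⟨_, (hE u v).2 ⟨hv, hy⟩, congrArg ρ₁ (hT u v)⟩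
  · obtain ⟨⟨u, v⟩, rfl⟩ := (glue F a n).surjective x
    obtain ⟨⟨u', v'⟩, rfl⟩ := (glue F a n).surjective y
    rw [hE] at hx hy
    change sympForm F m (ρ₁ (T _)) (ρ₁ (T _)) = _
    rw [hT, hT, h₁.isometry _ hx.2 _ hy.2,
      sympForm_glue, sympForm_glue, h₂.isometry v hx.1 v' hy.1]
  · obtain ⟨⟨u, v⟩, rfl⟩ := (glue F a n).surjective x
    rw [hE] at hx
    rw [LinearMap.comp_apply, hT] at hρ
    have hd := hd₁ _ hx.2 fun h0 => hρ (by rw [h0, map_zero])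
    rw [swt_glue] at hd ⊢
    have hb := swt_le (ρ₂ v)
    by_cases hv : v = 0
    · subst hv
      rw [map_zero, swt_zero] at hd
      dsimp only at hd ⊢
      omega
    · have := hd₂ v hx.1 hv
      dsimp only at hd ⊢
      omega

end IsSymplecticReduction

/-- The orthogonal complement of an isotropic subspace admits a symplectic reduction. -/
theorem exists_isSymplecticReduction_orthogonal {D : Submodule F (SympSpace F n)}
    (hD : D ≤ (sympForm F n).orthogonal D) :
    ∃ (m : ℕ) (ρ : SympSpace F n →ₗ[F] SympSpace F m),
      IsSymplecticReduction ((sympForm F n).orthogonal D) ρ := by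
  obtain ⟨m, ρ, hsurj, hiso⟩ := LinearMap.BilinForm.IsAlt.exists_surjective_isometry
    (B := (sympForm F n).restrict ((sympForm F n).orthogonal D))
    (fun x => sympForm_isAlt (x : SympSpace F n))
  obtain ⟨σ, hσ⟩ := LinearMap.exists_extend ρ
  have hσ' : ∀ x : (sympForm F n).orthogonal D, σ x = ρ x := fun x => LinearMap.congr_fun hσ x
  refine ⟨m, σ, ?_, fun t => ?_, fun x hx y hy => ?_⟩
  · rwa [BilinForm.orthogonal_orthogonal sympForm_nondegenerate sympForm_isAlt.isRefl]
  · obtain ⟨x, rfl⟩ := hsurj t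
    exact ⟨x, x.2, hσ' x⟩
  · rw [hσ' ⟨x, hx⟩, hσ' ⟨y, hy⟩, hiso]
    rfl

end SymplecticLinearAlgebra

section SubsystemCodes

open Module
open LinearMap (BilinForm)

variable {p : ℕ} [Fact p.Prime] {n : ℕ}

theorem sdual_coe (C : Submodule (ZMod p) (SympSpace (ZMod p) n)) :
    sdual p (C : Set (SympSpace (ZMod p) n)) = (sympForm (ZMod p) n).orthogonal C := by
  ext v
  refine forall₂_congr fun w _ => ?_
  rw [traceSymp, Algebra.trace_self_apply, ← sympForm_apply]
  exact sympForm_isAlt.eq_iff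

theorem natCard_submodule (C : Submodule (ZMod p) (SympSpace (ZMod p) n)) :
    Nat.card C = p ^ finrank (ZMod p) C := by
  rw [Module.natCard_eq_pow_finrank (K := ZMod p), Nat.card_zmod]

theorem minSwt_le {F : Type*} [Field F] {X : Set (SympSpace F n)} {v : SympSpace F n}
    (hv : v ∈ X) (h0 : v ≠ 0) : minSwt X ≤ swt v :=
  Nat.sInf_le ⟨v, ⟨hv, h0⟩, rfl⟩

theorem exists_swt_eq_minSwt {F : Type*} [Field F] {X : Set (SympSpace F n)}
    (hX : ∃ v ∈ X, v ≠ 0) : ∃ v ∈ X, v ≠ 0 ∧ swt v = minSwt X := by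
  obtain ⟨v, hv, h0⟩ := hX
  obtain ⟨w, ⟨hw, hw0⟩, h⟩ := Nat.sInf_mem (s := swt '' {v ∈ X | v ≠ 0}) ⟨_, v, ⟨hv, h0⟩, rfl⟩
  exact ⟨w, hw, hw0, h⟩

/-- A pure subsystem code yields a symplectic reduction `D^⊥ → F^{2(k+r)}` all of whose nonzero
vectors have weight at least `d`. -/
theorem IsSubsysCode.exists_isSymplecticReduction {k r d : ℕ}
    {C : AddSubgroup (SympSpace (ZMod p) n)} (h : IsSubsysCode p (p ^ k) (p ^ r) d C)
    (hpure : d ≤ minSwt (C : Set (SympSpace (ZMod p) n))) :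
    ∃ (E : Submodule (ZMod p) (SympSpace (ZMod p) n))
      (ρ : SympSpace (ZMod p) n →ₗ[ZMod p] SympSpace (ZMod p) (k + r)),
      IsSymplecticReduction E ρ ∧ ∀ x ∈ E, x ≠ 0 → d ≤ swt x := by
  obtain ⟨S, rfl⟩ := (AddSubgroup.toZModSubmodule (M := SympSpace (ZMod p) n) p).symm.surjective C
  obtain ⟨-, hcard, heq, hne⟩ := h
  set D := S ⊓ (sympForm (ZMod p) n).orthogonal S
  have hS : (((AddSubgroup.toZModSubmodule p).symm S : AddSubgroup (SympSpace (ZMod p) n)) :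
      Set (SympSpace (ZMod p) n)) = S := rfl
  have hDS : (S : Set (SympSpace (ZMod p) n)) ∩ sdual p (S : Set (SympSpace (ZMod p) n)) = D := by
    rw [sdual_coe]
    rfl
  rw [hS] at hpure
  rw [hS, hDS] at hcard heq hne
  rw [sdual_coe] at heq hne
  have hiso : D ≤ (sympForm (ZMod p) n).orthogonal D := fun x hx y hy => hx.2 y hy.1
  obtain ⟨m, ρ, hρ⟩ := exists_isSymplecticReduction_orthogonal hiso
  have hm := hρ.finrank_orthogonal_add
  rw [BilinForm.orthogonal_orthogonal sympForm_nondegenerate sympForm_isAlt.isRefl] at hm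
  have hcard' : p ^ k * p ^ r * Nat.card D = p ^ n := by
    rwa [ZMod.card] at hcard
  rw [natCard_submodule, ← pow_add, ← pow_add] at hcard'
  have := Nat.pow_right_injective (Fact.out : p.Prime).two_le hcard'
  obtain rfl : m = k + r := by omega
  refine ⟨_, ρ, hρ, fun x hx h0 => ?_⟩
  by_cases hSD : (S : Set (SympSpace (ZMod p) n)) = (sympForm (ZMod p) n).orthogonal D
  · exact (heq hSD).le.trans (minSwt_le hx h0)
  · by_cases hxS : x ∈ S
    · exact hpure.trans (minSwt_le hxS h0)
    · exact (hne hSD).le.trans (minSwt_le ⟨hx, hxS⟩ h0)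

/-- A symplectic reduction onto `F^{2m}` yields, for every `r < m`, a subsystem code with `r` gauge
dimensions and `m - r` logical dimensions. -/
theorem IsSymplecticReduction.exists_isSubsysCode {m r : ℕ} (hr : r < m)
    {E : Submodule (ZMod p) (SympSpace (ZMod p) n)}
    {ρ : SympSpace (ZMod p) n →ₗ[ZMod p] SympSpace (ZMod p) m}
    (h : IsSymplecticReduction E ρ) :
    ∃ x ∈ E, ρ x ≠ 0 ∧ ∃ C : AddSubgroup (SympSpace (ZMod p) n),
      IsSubsysCode p (p ^ (m - r)) (p ^ r) (swt x) C := by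
  obtain ⟨s, rfl⟩ := Nat.exists_eq_add_of_le hr.le
  have hs : 0 < s := by omega
  rw [Nat.add_sub_cancel_left]
  let ι : SympSpace (ZMod p) r →ₗ[ZMod p] SympSpace (ZMod p) (r + s) :=
    (glue (ZMod p) r s).toLinearMap ∘ₗ LinearMap.inl _ _ _
  have hι : ∀ t, ι t = glue (ZMod p) r s (t, 0) := fun _ => rfl
  have hιinj : Function.Injective ι :=
    (glue (ZMod p) r s).injective.comp LinearMap.inl_injective
  let C : Submodule (ZMod p) (SympSpace (ZMod p) n) := E ⊓ (LinearMap.range ι).comap ρ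
  have hCrank : finrank (ZMod p) C =
      2 * r + finrank (ZMod p) ((sympForm (ZMod p) n).orthogonal E) := by
    rw [h.finrank_inf_comap, LinearMap.finrank_range_of_inj hιinj, finrank_sympSpace]
  have hErank := h.finrank_orthogonal_add
  have hD : C ⊓ (sympForm (ZMod p) n).orthogonal C = (sympForm (ZMod p) n).orthogonal E := by
    refine le_antisymm (fun x hx => ?_) (le_inf (h.orthogonal_le_inf_comap _)
      (BilinForm.orthogonal_le inf_le_left))
    obtain ⟨⟨hxE, t, ht⟩, hx⟩ := hx
    refine h.mem_orthogonal_iff.2 ⟨hxE, ?_⟩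
    suffices t = 0 by rw [← ht, this, map_zero]
    refine eq_zero_of_sympForm_eq_zero fun w => sympForm_isAlt.eq_iff.1 ?_
    obtain ⟨y, hy, hyw⟩ := h.exists_mem_eq (ι w)
    have hxy : sympForm (ZMod p) n y x = 0 := hx y ⟨hy, w, hyw.symm⟩
    rw [← h.isometry y hy x hxE, hyw, ← ht, hι, hι, sympForm_glue] at hxy
    simpa using hxy
  have hDset : (C : Set (SympSpace (ZMod p) n)) ∩ sdual p (C : Set (SympSpace (ZMod p) n)) =
      (sympForm (ZMod p) n).orthogonal E := by
    rw [← hD, sdual_coe]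
    rfl
  have hDp : sdual p ((C : Set (SympSpace (ZMod p) n)) ∩
      sdual p (C : Set (SympSpace (ZMod p) n))) = E := by
    rw [hDset, sdual_coe,
      BilinForm.orthogonal_orthogonal sympForm_nondegenerate sympForm_isAlt.isRefl]
  have hnot : ∀ x, x ∈ E → x ∉ C → ρ x ≠ 0 := fun x hx hxC h0 =>
    hxC ⟨hx, by simp [h0]⟩
  obtain ⟨v, hvE, hvC⟩ : ∃ v ∈ E, v ∉ C := by
    obtain ⟨v, hv, hρv⟩ := h.exists_mem_eq
      (glue (ZMod p) r s (0, (fun _ => 1, fun _ => 1)))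
    refine ⟨v, hv, fun hvC => ?_⟩
    obtain ⟨t, ht⟩ := hvC.2
    have := (glue (ZMod p) r s).injective (ht.trans hρv)
    have := congrFun (congrArg (fun z => z.2.1) this) ⟨0, hs⟩
    simp at this
  obtain ⟨x, ⟨hxE, hxC⟩, -, hx⟩ := exists_swt_eq_minSwt
    (X := (E : Set (SympSpace (ZMod p) n)) \ C)
    ⟨v, ⟨hvE, hvC⟩, fun h0 => hvC (h0 ▸ C.zero_mem)⟩
  have hcardC : Nat.card C.toAddSubgroup = p ^ finrank (ZMod p) C := natCard_submodule C
  refine ⟨x, hxE, hnot x hxE hxC, C.toAddSubgroup, ?_, ?_, ?_, ?_⟩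
  · rw [hcardC, hCrank, ZMod.card, ← pow_add, ← pow_add]
    congr 1
    omega
  · change p ^ s * p ^ r * Nat.card ↑((C : Set (SympSpace (ZMod p) n)) ∩ sdual p C) = _
    rw [hDset, ZMod.card]
    change p ^ s * p ^ r * Nat.card ((sympForm (ZMod p) n).orthogonal E) = _
    rw [natCard_submodule, ← pow_add, ← pow_add]
    congr 1
    omega
  · change (C : Set (SympSpace (ZMod p) n)) =
      sdual p ((C : Set (SympSpace (ZMod p) n)) ∩ sdual p C) → _
    rw [hDp]
    exact fun hCE => absurd (hCE ▸ hvE : v ∈ (C : Set (SympSpace (ZMod p) n))) hvC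
  · intro _
    change swt x = minSwt (sdual p ((C : Set (SympSpace (ZMod p) n)) ∩ sdual p C) \ C)
    rw [hDp, hx]

end SubsystemCodes

/-- Combining binary subsystem codes: pure `[[n₁,k₁,r₁,d₁]]₂` and
`[[n₂,k₂,r₂,d₂]]₂` subsystem codes with `k₂ + r₂ ≤ n₁` yield, for every `0 ≤ r < k₁ + r₁`, an
`[[n₁+n₂-k₂-r₂, k₁+r₁-r, r, d]]₂` subsystem code with `d ≥ min{d₁, d₁+d₂-k₂-r₂}`. -/
theorem stmt_15 (n₁ n₂ k₁ r₁ d₁ k₂ r₂ d₂ : ℕ)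
    (h12 : k₂ + r₂ ≤ n₁)
    (h1 : ∃ C : AddSubgroup ((Fin n₁ → ZMod 2) × (Fin n₁ → ZMod 2)),
      IsSubsysCode 2 (2 ^ k₁) (2 ^ r₁) d₁ C ∧
      d₁ ≤ minSwt (C : Set ((Fin n₁ → ZMod 2) × (Fin n₁ → ZMod 2))))
    (h2 : ∃ C : AddSubgroup ((Fin n₂ → ZMod 2) × (Fin n₂ → ZMod 2)),
      IsSubsysCode 2 (2 ^ k₂) (2 ^ r₂) d₂ C ∧
      d₂ ≤ minSwt (C : Set ((Fin n₂ → ZMod 2) × (Fin n₂ → ZMod 2)))) :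
    ∀ r < k₁ + r₁, ∃ d : ℕ,
      min (d₁ : ℤ) ((d₁ : ℤ) + (d₂ : ℤ) - (k₂ : ℤ) - (r₂ : ℤ)) ≤ (d : ℤ) ∧
      ∃ C : AddSubgroup ((Fin (n₁ + n₂ - k₂ - r₂) → ZMod 2) ×
          (Fin (n₁ + n₂ - k₂ - r₂) → ZMod 2)),
        IsSubsysCode 2 (2 ^ (k₁ + r₁ - r)) (2 ^ r) d C := by
  intro r hr
  obtain ⟨C₁, hC₁, hpure₁⟩ := h1
  obtain ⟨C₂, hC₂, hpure₂⟩ := h2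
  obtain ⟨E₁, ρ₁, hρ₁, hd₁⟩ := hC₁.exists_isSymplecticReduction hpure₁
  obtain ⟨E₂, ρ₂, hρ₂, hd₂⟩ := hC₂.exists_isSymplecticReduction hpure₂
  obtain ⟨a, rfl⟩ := Nat.exists_eq_add_of_le' h12
  have hlen : a + (k₂ + r₂) + n₂ - k₂ - r₂ = a + n₂ := by omega
  rw [hlen]
  obtain ⟨E, ρ, hρ, hd⟩ := hρ₁.exists_glue hρ₂ hd₁ hd₂
  obtain ⟨x, hx, hρx, C, hC⟩ := hρ.exists_isSubsysCode hr
  refine ⟨swt x, ?_, C, hC⟩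
  have := hd x hx hρx
  push_cast at this
  rwa [← sub_sub] at this
end
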